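/- arXiv:2508.04613 — 2 statements merged into one kernel-verified Lean document; each statement's English description precedes it below -/
import Mathlib

section
/- Let f ∈ 𝒮(ℝ^d) be a Schwartz function, let (x_k, y_k) ∈ ℤ^d × ℤ^d and c_k ∈ ℂ for 1 ≤ k ≤ N−1, and let (α, β) ∈ ℝ^d × ℝ^d. If Σ_{k=1}^{N−1} c_k e^{−2πi⟨y_k,t⟩} f(t − x_k) = e^{−2πi⟨β,t⟩} f(t − α) for all t ∈ ℝ^d, then for all (t, ω) ∈ ℝ^d × ℝ^d one has p(t, ω) · Zf(t, ω) = e^{−2πi⟨t,β⟩} · Zf(t − α, ω + β), where p(t, ω) = Σ_{k=1}^{N−1} c_k e^{−2πi⟨y_k,t⟩} e^{−2πi⟨ω,x_k⟩}. -/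
/-- The Zak transform of a Schwartz function:
`Zf(t, ω) = Σ_{κ ∈ ℤ^d} e^{-2πi⟨ω,κ⟩} f(t + κ)`. -/
noncomputable def Zak {d : ℕ} (f : SchwartzMap (Fin d → ℝ) ℂ) (t ω : Fin d → ℝ) : ℂ :=
  ∑' κ : Fin d → ℤ,
    Complex.exp (-(2 * Real.pi * Complex.I) * (∑ i, ω i * (κ i : ℝ))) *
      f (t + fun i => (κ i : ℝ))

/-- The sum of a Schwartz function over any translate of the integer lattice converges absolutely. -/
theorem SchwartzMap.summable_norm_add_intCast {d : ℕ} (f : SchwartzMap (Fin d → ℝ) ℂ)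
    (t : Fin d → ℝ) : Summable fun κ : Fin d → ℤ => ‖f (t + fun i => (κ i : ℝ))‖ := by
  let L : Submodule ℤ (Fin d → ℝ) := Submodule.span ℤ (Set.range (Pi.basisFun ℝ (Fin d)))
  have hmem (κ : Fin d → ℤ) : (fun i => (κ i : ℝ)) ∈ L :=
    ((Pi.basisFun ℝ (Fin d)).mem_span_iff_repr_mem ℤ _).2 fun i => ⟨κ i, by simp⟩
  have hinj : Function.Injective fun κ : Fin d → ℤ => (fun i => (κ i : ℝ)) := fun κ κ' h =>
    funext fun i => by exact Int.cast_injective (congrFun h i)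
  have hsum : Summable fun κ : Fin d → ℤ =>
      ‖(t + fun i => (κ i : ℝ) : Fin d → ℝ)‖⁻¹ ^ (Module.finrank ℤ L + 1) := by
    have := (ZLattice.summable_norm_sub_inv_pow L _ (Nat.lt_succ_self _) (-t)).comp_injective
      (i := fun κ : Fin d → ℤ => (⟨_, hmem κ⟩ : L)) fun κ κ' h => hinj (Subtype.ext_iff.1 h)
    simpa [Function.comp_def, add_comm] using this
  obtain ⟨C, -, hC⟩ := f.decay (Module.finrank ℤ L + 1) 0
  have hne : ∀ᶠ κ : Fin d → ℤ in Filter.cofinite, (t + fun i => (κ i : ℝ) : Fin d → ℝ) ≠ 0 :=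
    ((add_right_injective t).comp hinj).tendsto_cofinite.eventually
      (Filter.eventually_cofinite_ne 0)
  refine Summable.of_norm_bounded_eventually (hsum.mul_left C) ?_
  filter_upwards [hne] with κ hκ
  have := hC (t + fun i => (κ i : ℝ))
  rw [norm_iteratedFDeriv_zero] at this
  rw [norm_norm, inv_pow, ← div_eq_mul_inv, le_div_iff₀ (by positivity), mul_comm]
  exact this

theorem Zak.summable {d : ℕ} (f : SchwartzMap (Fin d → ℝ) ℂ) (t ω : Fin d → ℝ) :
    Summable fun κ : Fin d → ℤ =>
      Complex.exp (-(2 * Real.pi * Complex.I) * (∑ i, ω i * (κ i : ℝ))) *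
        f (t + fun i => (κ i : ℝ)) := by
  refine .of_norm ((f.summable_norm_add_intCast t).congr fun κ => ?_)
  rw [norm_mul, Complex.norm_exp]
  simp

/-- The Zak transform is quasi-periodic in its first variable. -/
theorem Zak.sub_intCast {d : ℕ} (f : SchwartzMap (Fin d → ℝ) ℂ) (t ω : Fin d → ℝ)
    (x : Fin d → ℤ) :
    Zak f (t - fun i => (x i : ℝ)) ω =
      Complex.exp (-(2 * Real.pi * Complex.I) * (∑ i, ω i * (x i : ℝ))) * Zak f t ω := by
  rw [Zak, Zak, ← tsum_mul_left, ← (Equiv.addRight x).tsum_eq]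
  refine tsum_congr fun κ => ?_
  rw [← mul_assoc, ← Complex.exp_add]
  congr 2
  · simp only [Equiv.coe_addRight, Pi.add_apply, Int.cast_add, mul_add, Finset.sum_add_distrib,
      Complex.ofReal_add]
    ring
  · ext i
    simp

/-- Characters with integer frequency are invariant under integer translations. -/
theorem Complex.exp_neg_two_pi_I_mul_sum_add_intCast {d : ℕ} (y κ : Fin d → ℤ)
    (t : Fin d → ℝ) :
    Complex.exp (-(2 * Real.pi * Complex.I) *
        (∑ i, (y i : ℝ) * (t + fun i => (κ i : ℝ)) i)) =
      Complex.exp (-(2 * Real.pi * Complex.I) * (∑ i, (y i : ℝ) * t i)) := by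
  rw [Complex.exp_eq_exp_iff_exists_int]
  refine ⟨-∑ i, y i * κ i, ?_⟩
  simp only [Pi.add_apply, mul_add, Finset.sum_add_distrib]
  push_cast
  ring


/-- Applying the Zak transform to the linear dependence relation
`Σ_k c_k e^{-2πi⟨y_k,t⟩} f(t - x_k) = e^{-2πi⟨β,t⟩} f(t - α)` yields the functional
equation `p(t,ω) · Zf(t,ω) = e^{-2πi⟨t,β⟩} · Zf(t - α, ω + β)`, where
`p(t,ω) = Σ_k c_k e^{-2πi⟨y_k,t⟩} e^{-2πi⟨ω,x_k⟩}`. -/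
theorem zak_of_dependence (d N : ℕ)
    (f : SchwartzMap (Fin d → ℝ) ℂ)
    (x y : Fin (N - 1) → Fin d → ℤ) (c : Fin (N - 1) → ℂ)
    (α β : Fin d → ℝ)
    (hdep : ∀ t : Fin d → ℝ,
      ∑ k, c k * Complex.exp (-(2 * Real.pi * Complex.I) * (∑ i, (y k i : ℝ) * t i)) *
          f (t - fun i => (x k i : ℝ))
        = Complex.exp (-(2 * Real.pi * Complex.I) * (∑ i, β i * t i)) * f (t - α)) :
    ∀ t ω : Fin d → ℝ,
      (∑ k, c k * Complex.exp (-(2 * Real.pi * Complex.I) * (∑ i, (y k i : ℝ) * t i)) *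
          Complex.exp (-(2 * Real.pi * Complex.I) * (∑ i, ω i * (x k i : ℝ))))
        * Zak f t ω
      = Complex.exp (-(2 * Real.pi * Complex.I) * (∑ i, t i * β i)) *
          Zak f (t - α) (ω + β) := by
  intro t ω
  have hs (k : Fin (N - 1)) := (Zak.summable f (t - fun i => (x k i : ℝ)) ω).mul_left
    (c k * Complex.exp (-(2 * Real.pi * Complex.I) * (∑ i, (y k i : ℝ) * t i)))
  rw [Finset.sum_mul]
  simp_rw [mul_assoc (c _ * _), ← Zak.sub_intCast]
  simp only [Zak, ← tsum_mul_left]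
  rw [← Summable.tsum_finsetSum fun k _ => hs k]
  refine tsum_congr fun κ => ?_
  have h := congrArg
    (Complex.exp (-(2 * Real.pi * Complex.I) * (∑ i, ω i * (κ i : ℝ))) * ·)
    (hdep (t + fun i => (κ i : ℝ)))
  simp only [Complex.exp_neg_two_pi_I_mul_sum_add_intCast, Finset.mul_sum] at h
  rw [← mul_assoc, ← Complex.exp_add] at h
  rw [← mul_assoc, ← Complex.exp_add]
  convert h using 1
  · refine Finset.sum_congr rfl fun k _ => ?_
    rw [sub_add_eq_add_sub]
    ring
  · rw [sub_add_eq_add_sub]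
    congr 2
    push_cast [Pi.add_apply, mul_add, add_mul, Finset.sum_add_distrib]
    simp only [mul_comm (Complex.ofReal (β _)) (Complex.ofReal (t _))]
    ring
end

section
/- Let F : ℝ^{2d}/ℤ^{2d} → ℝ be continuous and nonnegative, let γ be an element of the torus G = ℝ^{2d}/ℤ^{2d}, let H be the closure of the subgroup generated by γ with normalized Haar measure m_H, and let q : G → ℝ be continuous with F(z + γ) = q(z) F(z) for all z ∈ G. Fix λ₀ ∈ G with q(λ₀ + h) > 0 for all h ∈ H, and suppose Θ(λ₀) := ∫_H ln q(λ₀ + h) dm_H(h) ≠ 0. Then F vanishes identically on the coset λ₀ + H; in particular F(λ₀) = 0. -/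
open MeasureTheory

section Cocycle

variable {K : Type*} [AddCommGroup K] {g : K} {f p : K → ℝ}

/-- The zero set of a solution of `f (x + g) = p x * f x` with `p` nowhere zero is invariant
under translation by all integer multiples of `g`. -/
theorem cocycle_add_zsmul_eq_zero (hp : ∀ x, p x ≠ 0) (hfp : ∀ x, f (x + g) = p x * f x)
    {x : K} (hx : f x = 0) (n : ℤ) : f (x + n • g) = 0 := by
  have step (y : K) : f (y + g) = 0 ↔ f y = 0 := by simp [hfp, hp]
  induction n with
  | zero => simpa using hx
  | succ n ih => rwa [add_smul, one_smul, ← add_assoc, step]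
  | pred n ih => rwa [← step, sub_smul, one_smul, add_assoc, sub_add_cancel]

/-- If the multiples of `g` are dense, a continuous solution of `f (x + g) = p x * f x` with `p`
nowhere zero vanishes either everywhere or nowhere. -/
theorem cocycle_eq_zero_of_exists_eq_zero [TopologicalSpace K] [IsTopologicalAddGroup K]
    (hg : Dense (AddSubgroup.zmultiples g : Set K)) (hf : Continuous f) (hp : ∀ x, p x ≠ 0)
    (hfp : ∀ x, f (x + g) = p x * f x) {x : K} (hx : f x = 0) (y : K) : f y = 0 := by
  have hclosed : IsClosed {k | f (x + k) = 0} :=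
    isClosed_eq (hf.comp (continuous_const_add x)) continuous_const
  have hsub : (AddSubgroup.zmultiples g : Set K) ⊆ {k | f (x + k) = 0} := by
    rintro _ ⟨n, rfl⟩
    exact cocycle_add_zsmul_eq_zero hp hfp hx n
  simpa using hclosed.closure_subset_iff.2 hsub (hg (y - x))

/-- A positive multiplicative coboundary on a compact group has zero mean logarithm. -/
theorem integral_log_eq_zero_of_cocycle [TopologicalSpace K] [IsTopologicalAddGroup K]
    [CompactSpace K] [MeasurableSpace K] [BorelSpace K] (μ : Measure K) [IsFiniteMeasure μ]
    [μ.IsAddRightInvariant] (hf : Continuous f) (hp : ∀ x, p x ≠ 0)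
    (hfp : ∀ x, f (x + g) = p x * f x) (hf0 : ∀ x, f x ≠ 0) :
    ∫ x, Real.log (p x) ∂μ = 0 := by
  have hlog : Continuous fun x => Real.log (f x) := hf.log hf0
  have hshift : Continuous fun x => Real.log (f (x + g)) := hlog.comp (continuous_add_const g)
  have hint {u : K → ℝ} (hu : Continuous u) : Integrable u μ :=
    hu.integrable_of_hasCompactSupport (HasCompactSupport.of_compactSpace u)
  have hcob (x : K) : Real.log (p x) = Real.log (f (x + g)) - Real.log (f x) := by
    rw [hfp, Real.log_mul (hp x) (hf0 x), add_sub_cancel_right]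
  simp_rw [hcob]
  rw [integral_sub (hint hshift) (hint hlog),
    integral_add_right_eq_self (fun x => Real.log (f x)) g, sub_self]

end Cocycle

/-- The multiples of `γ` are dense in the closure of the subgroup generated by `γ`. -/
theorem dense_zmultiples_of_eq_topologicalClosure {G : Type*} [AddCommGroup G]
    [TopologicalSpace G] [IsTopologicalAddGroup G] {γ : G} {H : AddSubgroup G}
    (hH : H = (AddSubgroup.zmultiples γ).topologicalClosure) (hγ : γ ∈ H) :
    Dense (AddSubgroup.zmultiples (⟨γ, hγ⟩ : H) : Set H) := by
  subst hH
  refine Subtype.dense_iff.2 (closure_mono ?_)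
  rintro _ ⟨n, rfl⟩
  exact ⟨n • ⟨γ, hγ⟩, ⟨n, rfl⟩, rfl⟩

/-- **Nonzero Lyapunov exponent forces vanishing on the coset.** Let `F` be continuous
and nonnegative on the torus `G = ℝ^{2d}/ℤ^{2d}`, let `H` be the closure of the subgroup
generated by `γ` with normalized Haar probability measure `m_H`, and let `q : G → ℝ` be
continuous with `F(z + γ) = q(z) F(z)` for all `z`.  If `q > 0` on `λ₀ + H` and
`Θ(λ₀) = ∫_H ln q(λ₀ + h) dm_H(h) ≠ 0`, then `F ≡ 0` on `λ₀ + H`; in particular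
`F(λ₀) = 0`. -/
theorem nonzero_exponent_forces_vanishing (d : ℕ)
    (F q : (Fin (2 * d) → AddCircle (1 : ℝ)) → ℝ)
    (hF : Continuous F) (hFnn : ∀ z, 0 ≤ F z) (hq : Continuous q)
    (γ : Fin (2 * d) → AddCircle (1 : ℝ))
    (H : AddSubgroup (Fin (2 * d) → AddCircle (1 : ℝ)))
    (hH : H = (AddSubgroup.zmultiples γ).topologicalClosure)
    (μ : Measure H) [IsProbabilityMeasure μ] [μ.IsAddHaarMeasure]
    (hcoc : ∀ z, F (z + γ) = q z * F z)
    (lam₀ : Fin (2 * d) → AddCircle (1 : ℝ))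
    (hqpos : ∀ h ∈ H, 0 < q (lam₀ + h))
    (hΘ : (∫ h : H, Real.log (q (lam₀ + (h : Fin (2 * d) → AddCircle (1 : ℝ)))) ∂μ) ≠ 0) :
    (∀ h ∈ H, F (lam₀ + h) = 0) ∧ F lam₀ = 0 := by
  have hγ : γ ∈ H := hH ▸ (AddSubgroup.zmultiples γ).le_topologicalClosure (AddSubgroup.mem_zmultiples γ)
  have hclosed : IsClosed (H : Set (Fin (2 * d) → AddCircle (1 : ℝ))) :=
    hH ▸ AddSubgroup.isClosed_topologicalClosure _
  have : CompactSpace H :=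
    isCompact_iff_compactSpace.1 hclosed.isCompact
  have hf : Continuous fun h : H => F (lam₀ + h) := by fun_prop
  have hp (h : H) : q (lam₀ + h) ≠ 0 := (hqpos h h.2).ne'
  have hfp (h : H) : F (lam₀ + (h + ⟨γ, hγ⟩ : H)) = q (lam₀ + h) * F (lam₀ + h) := by
    rw [← hcoc, AddSubgroup.coe_add, add_assoc]
  obtain ⟨x, hx⟩ : ∃ x : H, F (lam₀ + x) = 0 := by
    by_contra! hne
    exact hΘ (integral_log_eq_zero_of_cocycle μ hf hp hfp hne)
  have hzero (h : H) : F (lam₀ + h) = 0 :=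
    cocycle_eq_zero_of_exists_eq_zero (dense_zmultiples_of_eq_topologicalClosure hH hγ)
      hf hp hfp hx h
  exact ⟨fun h hh => hzero ⟨h, hh⟩, by simpa using hzero 0⟩
end
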